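/- Let D(x_1,...,x_p) be a polynomial with integer coefficients such that deg(D, x_i) ≥ 1 for each i ∈ {1,...,p}. Then there exist an integer n > p and a system T ⊆ E_n which satisfies the following two conditions for each K ∈ {ℤ, ℕ}: (Condition 1) for all x̃_1,...,x̃_p ∈ K, D(x̃_1,...,x̃_p) = 0 if and only if there exist x̃_{p+1},...,x̃_n ∈ K such that (x̃_1,...,x̃_p, x̃_{p+1},...,x̃_n) solves T; (Condition 2) for all x̃_1,...,x̃_p ∈ K with D(x̃_1,...,x̃_p) = 0, there exists a unique tuple (x̃_{p+1},...,x̃_n) ∈ K^(n−p) such that (x̃_1,...,x̃_p, x̃_{p+1},...,x̃_n) solves T. In particular, for each K ∈ {ℤ, ℕ}, the equation D(x_1,...,x_p) = 0 and the system T have the same number of solutions in K. -/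

import Mathlib

/-- An equation from `E_n`: one of `x k = 1`, `x i + x j = x k`, `x i * x j = x k`
with `i, j, k ∈ {1, ..., n}` (indices are represented by `Fin n`). -/
inductive Eqn (n : ℕ) where
  | one (k : Fin n)
  | add (i j k : Fin n)
  | mul (i j k : Fin n)

/-- A tuple satisfies a single equation. -/
def Eqn.Holds {n : ℕ} {α : Type*} [One α] [Add α] [Mul α] (x : Fin n → α) :
    Eqn n → Prop
  | .one k => x k = 1
  | .add i j k => x i + x j = x k
  | .mul i j k => x i * x j = x k

/-- A tuple solves a system `T ⊆ E_n`. -/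
def Solves {n : ℕ} {α : Type*} [One α] [Add α] [Mul α] (T : Set (Eqn n))
    (x : Fin n → α) : Prop :=
  ∀ e ∈ T, e.Holds x

open MvPolynomial in
/-- `S` is a set of polynomials, each of which is forced by the valid equations inside `S`. -/
def GoodSet {p : ℕ} (S : Set (MvPolynomial (Fin p) ℕ)) : Prop :=
  (∀ i, X i ∈ S) ∧ ∀ (R : Type) [CommSemiring R] [IsCancelAdd R] (f : MvPolynomial (Fin p) ℕ → R),
    (1 ∈ S → f 1 = 1) →
    (∀ a b, a ∈ S → b ∈ S → a + b ∈ S → f a + f b = f (a + b)) →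
    (∀ a b, a ∈ S → b ∈ S → a * b ∈ S → f a * f b = f (a * b)) →
    ∀ a ∈ S, f a = aeval (fun i => f (X i)) a

open MvPolynomial in
theorem GoodSet.union {p : ℕ} {S S' : Set (MvPolynomial (Fin p) ℕ)} (h : GoodSet S)
    (h' : GoodSet S') : GoodSet (S ∪ S') := by
  refine ⟨fun i => Or.inl (h.1 i), ?_⟩
  intro R _ _ f h1 ha hm a haS
  rcases haS with haS | haS
  · exact h.2 R f (fun q => h1 (Or.inl q))
      (fun a b x y z => ha a b (Or.inl x) (Or.inl y) (Or.inl z))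
      (fun a b x y z => hm a b (Or.inl x) (Or.inl y) (Or.inl z)) a haS
  · exact h'.2 R f (fun q => h1 (Or.inr q))
      (fun a b x y z => ha a b (Or.inr x) (Or.inr y) (Or.inr z))
      (fun a b x y z => hm a b (Or.inr x) (Or.inr y) (Or.inr z)) a haS

open MvPolynomial in
theorem GoodSet.insert_of {p : ℕ} {S : Set (MvPolynomial (Fin p) ℕ)} (h : GoodSet S)
    (c : MvPolynomial (Fin p) ℕ)
    (hc : c = 0 ∨ c = 1 ∨ (∃ a ∈ S, ∃ b ∈ S, c = a + b) ∨ (∃ a ∈ S, ∃ b ∈ S, c = a * b)) :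
    GoodSet (insert c S) := by
  refine ⟨fun i => Or.inr (h.1 i), ?_⟩
  intro R _ _ f h1 ha hm
  have key := h.2 R f (fun q => h1 (Or.inr q))
      (fun a b x y z => ha a b (Or.inr x) (Or.inr y) (Or.inr z))
      (fun a b x y z => hm a b (Or.inr x) (Or.inr y) (Or.inr z))
  intro a haS
  rcases haS with rfl | haS
  · rcases hc with rfl | rfl | ⟨u, hu, v, hv, rfl⟩ | ⟨u, hu, v, hv, rfl⟩
    · have := ha 0 0 (Or.inl rfl) (Or.inl rfl) (by rw [add_zero]; exact Or.inl rfl)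
      rw [add_zero] at this
      rw [map_zero]
      exact left_eq_add.mp this.symm
    · rw [map_one]; exact h1 (Or.inl rfl)
    · rw [← ha u v (Or.inr hu) (Or.inr hv) (Or.inl rfl), map_add, key u hu, key v hv]
    · rw [← hm u v (Or.inr hu) (Or.inr hv) (Or.inl rfl), map_mul, key u hu, key v hv]
  · exact key a haS

open MvPolynomial in
theorem goodSet_range (p : ℕ) : GoodSet (Set.range (X : Fin p → MvPolynomial (Fin p) ℕ)) := by
  refine ⟨fun i => ⟨i, rfl⟩, ?_⟩
  rintro R _ _ f - - - _ ⟨i, rfl⟩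
  simp

open MvPolynomial in
theorem exists_goodSet {p : ℕ} (P : MvPolynomial (Fin p) ℕ) :
    ∃ S, S.Finite ∧ GoodSet S ∧ P ∈ S := by
  induction P using MvPolynomial.induction_on with
  | C a =>
    induction a with
    | zero =>
      exact ⟨_, (Set.finite_range _).insert _, (goodSet_range p).insert_of (C 0) (Or.inl (by simp)),
        Or.inl rfl⟩
    | succ a ih =>
      obtain ⟨S, hf, hS, ha⟩ := ih
      have h1 := hS.insert_of 1 (Or.inr (Or.inl rfl))
      refine ⟨_, (hf.insert _).insert _, h1.insert_of (C (a + 1))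
        (Or.inr (Or.inr (Or.inl ⟨C a, Or.inr ha, 1, Or.inl rfl, by simp⟩))), Or.inl rfl⟩
  | add a b iha ihb =>
    obtain ⟨S, hf, hS, ha⟩ := iha
    obtain ⟨S', hf', hS', hb⟩ := ihb
    exact ⟨_, (hf.union hf').insert _, (hS.union hS').insert_of (a + b)
      (Or.inr (Or.inr (Or.inl ⟨a, Or.inl ha, b, Or.inr hb, rfl⟩))), Or.inl rfl⟩
  | mul_X a i iha =>
    obtain ⟨S, hf, hS, ha⟩ := iha
    exact ⟨_, hf.insert _, hS.insert_of (a * X i)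
      (Or.inr (Or.inr (Or.inr ⟨a, ha, X i, hS.1 i, rfl⟩))), Or.inl rfl⟩

open MvPolynomial in
theorem exists_enum {p : ℕ} (S : Set (MvPolynomial (Fin p) ℕ)) (hf : S.Finite)
    (hX : ∀ i, X i ∈ S) (h0 : 0 ∈ S) :
    ∃ (n : ℕ) (hpn : p < n) (g : Fin n → MvPolynomial (Fin p) ℕ),
      Function.Injective g ∧ Set.range g = S ∧ ∀ i, g (Fin.castLE hpn.le i) = X i := by
  classical
  have hfin : (S \ Set.range (X : Fin p → MvPolynomial (Fin p) ℕ)).Finite := hf.sdiff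
  set U := hfin.toFinset with hU
  have hmem : ∀ a, a ∈ U ↔ a ∈ S ∧ ¬ ∃ i, X i = a := by
    intro a; simp [hU]
  have h0U : (0 : MvPolynomial (Fin p) ℕ) ∈ U := by
    rw [hmem]
    exact ⟨h0, fun ⟨i, hi⟩ => X_ne_zero i hi⟩
  have hpos : 0 < U.card := Finset.card_pos.mpr ⟨0, h0U⟩
  refine ⟨p + U.card, by omega,
    Fin.append X (fun k => (U.equivFin.symm k : MvPolynomial (Fin p) ℕ)), ?_, ?_, ?_⟩
  · rw [Fin.append_injective_iff]
    refine ⟨X_injective, Subtype.val_injective.comp U.equivFin.symm.injective, ?_⟩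
    intro i j hij
    exact ((hmem _).1 (U.equivFin.symm j).2).2 ⟨i, hij⟩
  · ext a
    constructor
    · rintro ⟨k, rfl⟩
      refine Fin.addCases (fun i => ?_) (fun j => ?_) k
      · rw [Fin.append_left]; exact hX i
      · rw [Fin.append_right]; exact ((hmem _).1 (U.equivFin.symm j).2).1
    · intro ha
      by_cases hx : ∃ i, X i = a
      · obtain ⟨i, rfl⟩ := hx
        exact ⟨Fin.castAdd _ i, Fin.append_left _ _ _⟩
      · refine ⟨Fin.natAdd _ (U.equivFin ⟨a, (hmem a).2 ⟨ha, hx⟩⟩), ?_⟩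
        rw [Fin.append_right]; simp
  · intro i
    exact Fin.append_left _ _ i

open MvPolynomial in
theorem core_system {p : ℕ} (P Q : MvPolynomial (Fin p) ℕ) :
    ∃ (n : ℕ) (hpn : p < n) (T : Set (Eqn n)) (g : Fin n → MvPolynomial (Fin p) ℕ),
      (∀ i, g (Fin.castLE hpn.le i) = X i) ∧
      ∀ (R : Type) [CommSemiring R] [IsCancelAdd R] (z : Fin n → R),
        Solves T z ↔ (∀ k, z k = aeval (fun i => z (Fin.castLE hpn.le i)) (g k)) ∧
          aeval (fun i => z (Fin.castLE hpn.le i)) P =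
            aeval (fun i => z (Fin.castLE hpn.le i)) Q := by
  obtain ⟨S₁, hf₁, hS₁, hP⟩ := exists_goodSet P
  obtain ⟨S₂, hf₂, hS₂, hQ⟩ := exists_goodSet Q
  have hS := (hS₁.union hS₂).insert_of 0 (Or.inl rfl)
  have hf := (hf₁.union hf₂).insert 0
  obtain ⟨n, hpn, g, hinj, hr, hg⟩ := exists_enum _ hf hS.1 (Or.inl rfl)
  rw [← hr] at hS
  obtain ⟨k0, hk0⟩ : (0 : MvPolynomial (Fin p) ℕ) ∈ Set.range g := hr ▸ Or.inl rfl
  obtain ⟨k1, hk1⟩ : P ∈ Set.range g := hr ▸ Or.inr (Or.inl hP)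
  obtain ⟨k2, hk2⟩ : Q ∈ Set.range g := hr ▸ Or.inr (Or.inr hQ)
  refine ⟨n, hpn, {e | e.Holds g} ∪ {Eqn.add k1 k0 k2}, g, hg, ?_⟩
  intro R _ _ z
  constructor
  · intro h
    have hz : ∀ k, z k = aeval (fun i => z (Fin.castLE hpn.le i)) (g k) := by
      have hinv : ∀ k, Function.extend g z 0 (g k) = z k := fun k => hinj.extend_apply z 0 k
      have := hS.2 R (Function.extend g z 0) ?_ ?_ ?_
      · intro k
        have h2 := this (g k) ⟨k, rfl⟩
        simp only [← hg, hinv] at h2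
        exact h2
      · rintro ⟨k, hk⟩
        rw [← hk, hinv]
        exact h (Eqn.one k) (Or.inl hk)
      · rintro _ _ ⟨i, rfl⟩ ⟨j, rfl⟩ ⟨k, hk⟩
        rw [← hk, hinv, hinv, hinv]
        exact h (Eqn.add i j k) (Or.inl hk.symm)
      · rintro _ _ ⟨i, rfl⟩ ⟨j, rfl⟩ ⟨k, hk⟩
        rw [← hk, hinv, hinv, hinv]
        exact h (Eqn.mul i j k) (Or.inl hk.symm)
    refine ⟨hz, ?_⟩
    have h3 : z k1 + z k0 = z k2 := h (Eqn.add k1 k0 k2) (Or.inr rfl)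
    rw [hz k1, hz k0, hz k2, hk0, hk1, hk2, map_zero, add_zero] at h3
    exact h3
  · rintro ⟨hz, hPQ⟩ e (he | rfl)
    · cases e with
      | one k =>
        change g k = 1 at he
        change z k = 1
        rw [hz k, he, map_one]
      | add i j k =>
        change g i + g j = g k at he
        change z i + z j = z k
        rw [hz k, hz i, hz j, ← he, map_add]
      | mul i j k =>
        change g i * g j = g k at he
        change z i * z j = z k
        rw [hz k, hz i, hz j, ← he, map_mul]
    · change z k1 + z k0 = z k2
      rw [hz k1, hz k0, hz k2, hk0, hk1, hk2, map_zero, add_zero, hPQ]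

open MvPolynomial in
theorem exists_pos_neg {p : ℕ} (D : MvPolynomial (Fin p) ℤ) :
    ∃ P Q : MvPolynomial (Fin p) ℕ, ∀ x : Fin p → ℤ, eval x D = aeval x P - aeval x Q := by
  induction D using MvPolynomial.induction_on with
  | C a =>
    refine ⟨C a.toNat, C (-a).toNat, fun x => ?_⟩
    simp [-Int.ofNat_toNat]
    omega
  | add a b iha ihb =>
    obtain ⟨P, Q, h⟩ := iha
    obtain ⟨P', Q', h'⟩ := ihb
    refine ⟨P + P', Q + Q', fun x => ?_⟩
    rw [map_add, map_add, map_add, h, h']; ring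
  | mul_X a i iha =>
    obtain ⟨P, Q, h⟩ := iha
    refine ⟨P * X i, Q * X i, fun x => ?_⟩
    rw [map_mul, map_mul, map_mul, h]; simp; ring

open MvPolynomial in
/-- The conclusion over one semiring, given the description of the solutions. -/
theorem system_conclusion {p n : ℕ} {hpn : p < n} {T : Set (Eqn n)}
    {g : Fin n → MvPolynomial (Fin p) ℕ} (hg : ∀ i, g (Fin.castLE hpn.le i) = X i)
    {P Q : MvPolynomial (Fin p) ℕ} (R : Type) [CommSemiring R] (Z : (Fin p → R) → Prop)
    (hZ : ∀ x, Z x ↔ aeval x P = aeval x Q)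
    (hT : ∀ z : Fin n → R,
        Solves T z ↔ (∀ k, z k = aeval (fun i => z (Fin.castLE hpn.le i)) (g k)) ∧
          aeval (fun i => z (Fin.castLE hpn.le i)) P =
            aeval (fun i => z (Fin.castLE hpn.le i)) Q) :
    (∀ x : Fin p → R, Z x ↔
        ∃ z : Fin n → R, (∀ i : Fin p, z (Fin.castLE hpn.le i) = x i) ∧ Solves T z) ∧
    (∀ x : Fin p → R, Z x →
        ∀ z w : Fin n → R,
          (∀ i : Fin p, z (Fin.castLE hpn.le i) = x i) → Solves T z →
          (∀ i : Fin p, w (Fin.castLE hpn.le i) = x i) → Solves T w →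
          z = w) ∧
    Cardinal.mk {x : Fin p → R | Z x} = Cardinal.mk {z : Fin n → R | Solves T z} := by
  have hsol : ∀ x, Z x → Solves T (fun k => aeval x (g k)) := by
    intro x hx
    rw [hT]
    simp only [hg, aeval_X]
    exact ⟨fun _ => trivial, (hZ x).1 hx⟩
  have hback : ∀ z, Solves T z → Z (fun i => z (Fin.castLE hpn.le i)) :=
    fun z hz => (hZ _).2 ((hT z).1 hz).2
  refine ⟨fun x => ⟨fun hx => ⟨_, fun i => by simp [hg], hsol x hx⟩, ?_⟩, ?_, ?_⟩
  · rintro ⟨z, hzx, hz⟩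
    have := hback z hz
    rwa [funext hzx] at this
  · intro x _ z w hzx hz hwx hw
    funext k
    rw [((hT z).1 hz).1 k, ((hT w).1 hw).1 k, funext hzx, funext hwx]
  · refine Cardinal.mk_congr ⟨fun x => ⟨_, hsol x.1 x.2⟩, fun z => ⟨_, hback z.1 z.2⟩, ?_, ?_⟩
    · rintro ⟨x, hx⟩
      apply Subtype.ext
      funext i
      simp [hg]
    · rintro ⟨z, hz⟩
      apply Subtype.ext
      funext k
      exact (((hT z).1 hz).1 k).symm

theorem stmt_17 (p : ℕ) (D : MvPolynomial (Fin p) ℤ)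
    (hdeg : ∀ i : Fin p, 1 ≤ D.degreeOf i) :
    ∃ (n : ℕ) (hpn : p < n) (T : Set (Eqn n)),
      -- Condition 1 over ℤ
      (∀ x : Fin p → ℤ, MvPolynomial.eval x D = 0 ↔
        ∃ z : Fin n → ℤ, (∀ i : Fin p, z (Fin.castLE hpn.le i) = x i) ∧ Solves T z) ∧
      -- Condition 1 over ℕ
      (∀ x : Fin p → ℕ, MvPolynomial.eval (fun i => ((x i : ℤ))) D = 0 ↔
        ∃ z : Fin n → ℕ, (∀ i : Fin p, z (Fin.castLE hpn.le i) = x i) ∧ Solves T z) ∧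
      -- Condition 2 over ℤ
      (∀ x : Fin p → ℤ, MvPolynomial.eval x D = 0 →
        ∀ z w : Fin n → ℤ,
          (∀ i : Fin p, z (Fin.castLE hpn.le i) = x i) → Solves T z →
          (∀ i : Fin p, w (Fin.castLE hpn.le i) = x i) → Solves T w →
          z = w) ∧
      -- Condition 2 over ℕ
      (∀ x : Fin p → ℕ, MvPolynomial.eval (fun i => ((x i : ℤ))) D = 0 →
        ∀ z w : Fin n → ℕ,
          (∀ i : Fin p, z (Fin.castLE hpn.le i) = x i) → Solves T z →
          (∀ i : Fin p, w (Fin.castLE hpn.le i) = x i) → Solves T w →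
          z = w) ∧
      -- the equation and the system have the same number of solutions in ℤ
      Cardinal.mk {x : Fin p → ℤ | MvPolynomial.eval x D = 0} =
        Cardinal.mk {z : Fin n → ℤ | Solves T z} ∧
      -- the equation and the system have the same number of solutions in ℕ
      Cardinal.mk {x : Fin p → ℕ | MvPolynomial.eval (fun i => ((x i : ℤ))) D = 0} =
        Cardinal.mk {z : Fin n → ℕ | Solves T z} := by
  obtain ⟨P, Q, hPQ⟩ := exists_pos_neg D
  obtain ⟨n, hpn, T, g, hg, hT⟩ := core_system P Q
  obtain ⟨a1, a2, a3⟩ := system_conclusion (hpn := hpn) hg ℤ (fun x => MvPolynomial.eval x D = 0)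
    (fun x => by rw [hPQ, sub_eq_zero]) (hT ℤ)
  have hcast : ∀ (x : Fin p → ℕ) (F : MvPolynomial (Fin p) ℕ),
      MvPolynomial.aeval (fun i => (x i : ℤ)) F = ((MvPolynomial.aeval x F : ℕ) : ℤ) := by
    intro x F
    exact MvPolynomial.aeval_algebraMap_apply ℤ x F
  obtain ⟨b1, b2, b3⟩ := system_conclusion (hpn := hpn) hg ℕ
    (fun x => MvPolynomial.eval (fun i => ((x i : ℤ))) D = 0)
    (fun x => by rw [hPQ, sub_eq_zero, hcast, hcast, Nat.cast_inj]) (hT ℕ)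
  exact ⟨n, hpn, T, a1, b1, a2, b2, a3, b3⟩
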